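/- Every solution x : ℝ → ℝ⁴ of the geodesic equation d²x^μ/dλ² + Γ^μ_{νλ}(dx^ν/dλ)(dx^λ/dλ) = 0 with Γ^μ_{νλ} = −(x_ν δ^μ_λ + δ^μ_ν x_λ)/(x·x), whose trajectory stays in {x·x ≠ 0} and has dx⁰/dλ ≠ 0, satisfies x^i = a^i x⁰ + l b^i for constants a^i, b^i (i = 1,2,3); i.e., the spatial coordinates are affine functions of x⁰ along the geodesic. -/

import Mathlib

open scoped BigOperators

/-- Sign of the Minkowski metric η = diag(1,-1,-1,-1). -/
def etaS (μ : Fin 4) : ℝ := if μ = 0 then 1 else -1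

/-- Minkowski metric components η_{μν}. -/
def etaM (μ ν : Fin 4) : ℝ := if μ = ν then etaS μ else 0

/-- Minkowski inner product x·y = η_{μν}x^μy^ν. -/
def mdot (x y : Fin 4 → ℝ) : ℝ := ∑ μ, etaS μ * x μ * y μ

/-- Lowered components x_μ = η_{μν}x^ν. -/
def lowerIdx (x : Fin 4 → ℝ) (μ : Fin 4) : ℝ := etaS μ * x μ

/-- Connection coefficients Γ^μ_{νλ}(x) = −(x_ν δ^μ_λ + δ^μ_ν x_λ)/(x·x). -/
noncomputable def Gam (x : Fin 4 → ℝ) (μ ν lam : Fin 4) : ℝ :=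
  -((lowerIdx x ν) * (if μ = lam then (1:ℝ) else 0)
    + (if μ = ν then (1:ℝ) else 0) * lowerIdx x lam) / mdot x x

/-- The degenerate metric, sign `s`: g_{μν} = s·(l²/(x·x)²)(η_{μρ}η_{ντ} − η_{μν}η_{ρτ})x^ρx^τ. -/
noncomputable def gten (l s : ℝ) (x : Fin 4 → ℝ) (μ ν : Fin 4) : ℝ :=
  s * (l ^ 2 / (mdot x x) ^ 2) *
    ∑ ρ, ∑ τ, (etaM μ ρ * etaM ν τ - etaM μ ν * etaM ρ τ) * x ρ * x τ

/-- The degenerate (2,0)-tensor h^{μν} = l⁻⁴(x·x)x^μx^ν. -/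
noncomputable def hten (l : ℝ) (x : Fin 4 → ℝ) (μ ν : Fin 4) : ℝ :=
  (1 / l ^ 4) * mdot x x * x μ * x ν

/-- Partial derivative ∂_μ f at x. -/
noncomputable def pd (f : (Fin 4 → ℝ) → ℝ) (μ : Fin 4) (x : Fin 4 → ℝ) : ℝ :=
  fderiv ℝ f x (Pi.single μ 1)

/-- The quadratic form of the connection is proportional to the velocity. -/
theorem sum_Gam_mul_mul (x v : Fin 4 → ℝ) (μ : Fin 4) :
    ∑ ν, ∑ lam, Gam x μ ν lam * v ν * v lam = -2 * mdot x v / mdot x x * v μ := by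
  simp only [Gam]
  generalize mdot x x = D
  simp only [mdot, lowerIdx, Fin.sum_univ_four]
  fin_cases μ <;> simp <;> ring

/-- Two functions whose velocities have parallel derivatives are affinely related. -/
theorem exists_affine_of_deriv_deriv_mul_eq {f g : ℝ → ℝ} (hf : ContDiff ℝ 2 f)
    (hg : ContDiff ℝ 2 g) (hg' : ∀ s, deriv g s ≠ 0)
    (h : ∀ s, deriv (deriv f) s * deriv g s = deriv f s * deriv (deriv g) s) :
    ∃ a b : ℝ, ∀ s, f s = a * g s + b := by
  have hdf : Differentiable ℝ f := hf.differentiable two_ne_zero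
  have hdg : Differentiable ℝ g := hg.differentiable two_ne_zero
  have hddf : Differentiable ℝ (deriv f) := hf.differentiable_deriv_two
  have hddg : Differentiable ℝ (deriv g) := hg.differentiable_deriv_two
  have hratio : ∀ s, HasDerivAt (fun u => deriv f u / deriv g u) 0 s := fun s =>
    ((hddf s).hasDerivAt.fun_div (hddg s).hasDerivAt (hg' s)).congr_deriv <| by
      rw [h s, sub_self, zero_div]
  have hconst : ∀ s, deriv f s = deriv f 0 / deriv g 0 * deriv g s := fun s => by
    rw [← div_eq_iff (hg' s)]
    exact is_const_of_deriv_eq_zero (fun u => (hratio u).differentiableAt)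
      (fun u => (hratio u).deriv) s 0
  set a := deriv f 0 / deriv g 0
  have hdiff : ∀ s, HasDerivAt (fun u => f u - a * g u) 0 s := fun s =>
    ((hdf s).hasDerivAt.fun_sub ((hdg s).hasDerivAt.const_mul a)).congr_deriv <| by
      rw [hconst s, sub_self]
  refine ⟨a, f 0 - a * g 0, fun s => ?_⟩
  have hs := is_const_of_deriv_eq_zero (fun u => (hdiff u).differentiableAt)
    (fun u => (hdiff u).deriv) s 0
  linear_combination hs

/-- Every geodesic of the connection Γ^μ_{νλ} = −(x_νδ^μ_λ + δ^μ_νx_λ)/(x·x) staying in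
{x·x ≠ 0} with dx⁰/dλ ≠ 0 is a 'uniform rectilinear' motion: x^i = a^i x⁰ + l b^i. -/
theorem geodesics_are_uniform_rectilinear (l : ℝ) (hl : 0 < l)
    (x : ℝ → Fin 4 → ℝ) (hx : ∀ μ : Fin 4, ContDiff ℝ 2 (fun s => x s μ))
    (hgeo : ∀ s : ℝ, ∀ μ : Fin 4,
      deriv (deriv (fun u => x u μ)) s
        + ∑ ν, ∑ lam, Gam (x s) μ ν lam * deriv (fun u => x u ν) s
            * deriv (fun u => x u lam) s = 0)
    (hcone : ∀ s : ℝ, mdot (x s) (x s) ≠ 0)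
    (h0 : ∀ s : ℝ, deriv (fun u => x u 0) s ≠ 0) :
    ∃ a b : Fin 3 → ℝ, ∀ s : ℝ, ∀ i : Fin 3,
      x s i.succ = a i * x s 0 + l * b i := by
  have haccel : ∀ s μ, deriv (deriv fun u => x u μ) s =
      2 * mdot (x s) (fun ν => deriv (fun u => x u ν) s) / mdot (x s) (x s)
        * deriv (fun u => x u μ) s := fun s μ => by
    have h := hgeo s μ
    rw [sum_Gam_mul_mul (x s) (fun ν => deriv (fun u => x u ν) s) μ] at h
    linear_combination h
  choose a b hab using fun i : Fin 3 =>
    exists_affine_of_deriv_deriv_mul_eq (hx i.succ) (hx 0) h0 fun s => by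
      rw [haccel s i.succ, haccel s 0]
      ring
  refine ⟨a, fun i => b i / l, fun s i => ?_⟩
  rw [hab i s, mul_div_cancel₀ _ hl.ne']
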